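/- Every finitely generated subgroup of GL_n(ℂ) is residually finite (Mal'cev's theorem). -/

import Mathlib

/-- A group is residually finite if every nontrivial element survives in some
finite quotient, i.e. lies outside a normal subgroup of finite index. -/
def ResiduallyFinite (G : Type*) [Group G] : Prop :=
  ∀ g : G, g ≠ 1 → ∃ N : Subgroup G, N.Normal ∧ N.FiniteIndex ∧ g ∉ N

/-- `ℤ` is a Jacobson ring. -/
lemma malcev_int_jacobson : IsJacobsonRing ℤ := by
  rw [isJacobsonRing_iff_prime_eq]
  intro P hP
  by_cases h : P = ⊥
  · subst h
    refine le_antisymm ?_ bot_le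
    intro x hx
    rw [Ideal.mem_jacobson_bot] at hx
    have h1 := hx x
    have h2 := hx (-x)
    have h3 := hx 2
    have h4 := hx (-2)
    rw [Int.isUnit_iff] at h1 h2 h3 h4
    simp only [Ideal.mem_bot]
    omega
  · have := hP.isMaximal h
    exact Ideal.jacobson_eq_self_of_isMaximal

/-- A field of finite type over `ℤ` is finite. -/
lemma malcev_finite_field (K : Type*) [Field K] [Algebra.FiniteType ℤ K] : Finite K := by
  have := malcev_int_jacobson
  have hfin : Module.Finite ℤ K := finite_of_finite_type_of_isJacobsonRing ℤ K
  obtain ⟨p, hp⟩ := CharP.exists K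
  rcases CharP.char_is_prime_or_zero K p with h | h
  · have : Fact p.Prime := ⟨h⟩
    let _ := ZMod.algebra K p
    have : Module.Finite (ZMod p) K := Module.Finite.of_restrictScalars_finite ℤ (ZMod p) K
    exact Module.finite_of_finite (ZMod p)
  · subst h
    have : CharZero K := CharP.charP_to_charZero K
    exact absurd (isField_of_isIntegral_of_isField (R := ℤ) (S := K)
      (algebraMap ℤ K).injective_int (Field.toIsField K)) Int.not_isField

/-- A field that is a quotient of a ring of finite type over `ℤ` is finite. -/
lemma malcev_finite_of_surjective {A K : Type*} [CommRing A] [Algebra.FiniteType ℤ A] [Field K]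
    (f : A →+* K) (hf : Function.Surjective f) : Finite K := by
  have : Algebra.FiniteType ℤ K := Algebra.FiniteType.of_surjective f.toIntAlgHom hf
  exact malcev_finite_field K

/-- In a domain of finite type over `ℤ`, a nonzero element survives in a finite field. -/
lemma malcev_separate (A : Type*) [CommRing A] [IsDomain A] [Algebra.FiniteType ℤ A]
    (a : A) (ha : a ≠ 0) : ∃ M : Ideal A, Finite (A ⧸ M) ∧ a ∉ M := by
  have := malcev_int_jacobson
  have : IsJacobsonRing A := isJacobsonRing_of_finiteType (A := ℤ)
  have hj : (⊥ : Ideal A).jacobson = ⊥ :=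
    isJacobsonRing_iff_prime_eq.1 this _ Ideal.isPrime_bot
  by_contra! hcon
  apply ha
  have : a ∈ (⊥ : Ideal A).jacobson := by
    rw [Ideal.jacobson, Ideal.mem_sInf]
    rintro M ⟨-, hM⟩
    let _ := Ideal.Quotient.field M
    exact hcon M (malcev_finite_of_surjective (Ideal.Quotient.mk M) Ideal.Quotient.mk_surjective)
  rwa [hj] at this

/-- Mal'cev's theorem: every finitely generated subgroup of `GL_n(ℂ)` is
residually finite. -/
theorem stmt_13 (n : ℕ) (G : Subgroup (GL (Fin n) ℂ)) (hfg : Group.FG G) :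
    ResiduallyFinite G := by
  rw [Group.fg_iff_subgroup_fg] at hfg
  obtain ⟨S, hS⟩ := hfg
  let T : Set ℂ := ⋃ s ∈ S, ⋃ i, ⋃ j,
    {(s : Matrix (Fin n) (Fin n) ℂ) i j, ((s⁻¹ : GL (Fin n) ℂ) : Matrix (Fin n) (Fin n) ℂ) i j}
  have hT : T.Finite := by
    refine S.finite_toSet.biUnion fun s _ => ?_
    exact Set.finite_iUnion fun i => Set.finite_iUnion fun j => Set.toFinite _
  let A : Subalgebra ℤ ℂ := Algebra.adjoin ℤ T
  have hA : Algebra.FiniteType ℤ A :=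
    (Subalgebra.fg_iff_finiteType A).1 ⟨hT.toFinset, by rw [hT.coe_toFinset]⟩
  let f : GL (Fin n) A →* GL (Fin n) ℂ := Matrix.GeneralLinearGroup.map (A.subtype : A →+* ℂ)
  have hf : Function.Injective f := by
    intro x y hxy
    ext i j
    have := congrArg (fun z : GL (Fin n) ℂ => (z : Matrix (Fin n) (Fin n) ℂ) i j) hxy
    simpa [f] using this
  have hle : G ≤ f.range := by
    rw [← hS, Subgroup.closure_le]
    intro s hs
    have h1 : ∀ i j, (s : Matrix (Fin n) (Fin n) ℂ) i j ∈ A := fun i j =>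
      Algebra.subset_adjoin (by
        simp only [T, Set.mem_iUnion]
        exact ⟨s, hs, i, j, Or.inl rfl⟩)
    have h2 : ∀ i j, ((s⁻¹ : GL (Fin n) ℂ) : Matrix (Fin n) (Fin n) ℂ) i j ∈ A := fun i j =>
      Algebra.subset_adjoin (by
        simp only [T, Set.mem_iUnion]
        exact ⟨s, hs, i, j, Or.inr rfl⟩)
    let B : Matrix (Fin n) (Fin n) A := fun i j => ⟨_, h1 i j⟩
    let C : Matrix (Fin n) (Fin n) A := fun i j => ⟨_, h2 i j⟩
    have hinj : Function.Injective
        (fun X : Matrix (Fin n) (Fin n) A => X.map (A.subtype : A →+* ℂ)) :=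
      Matrix.map_injective Subtype.val_injective
    have hB : B.map (A.subtype : A →+* ℂ) = (s : Matrix (Fin n) (Fin n) ℂ) := rfl
    have hC : C.map (A.subtype : A →+* ℂ) =
      ((s⁻¹ : GL (Fin n) ℂ) : Matrix (Fin n) (Fin n) ℂ) := rfl
    refine ⟨⟨B, C, hinj ?_, hinj ?_⟩, ?_⟩
    · simp only [Matrix.map_mul, hB, hC]
      rw [Units.mul_inv, Matrix.map_one _ (map_zero _) (map_one _)]
    · simp only [Matrix.map_mul, hB, hC]
      rw [Units.inv_mul, Matrix.map_one _ (map_zero _) (map_one _)]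
    · ext i j
      rfl
  let ψ : G →* GL (Fin n) A :=
    (MonoidHom.ofInjective hf).symm.toMonoidHom.comp (Subgroup.inclusion hle)
  have hψ : Function.Injective ψ :=
    (MonoidHom.ofInjective hf).symm.injective.comp (Subgroup.inclusion_injective hle)
  intro g hg
  have hne : ψ g ≠ 1 := fun h => hg (hψ (by rw [h, map_one]))
  obtain ⟨i, j, hij⟩ : ∃ i j, (ψ g : Matrix (Fin n) (Fin n) A) i j ≠ (1 : Matrix _ _ A) i j := by
    by_contra! hcon
    exact hne (Units.ext (Matrix.ext hcon))
  obtain ⟨M, hM, haM⟩ := malcev_separate A _ (sub_ne_zero.2 hij)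
  let φ : G →* GL (Fin n) (A ⧸ M) :=
    (Matrix.GeneralLinearGroup.map (Ideal.Quotient.mk M)).comp ψ
  have : Finite (GL (Fin n) (A ⧸ M)) := inferInstance
  refine ⟨φ.ker, inferInstance, inferInstance, fun hk => haM ?_⟩
  rw [MonoidHom.mem_ker] at hk
  have h := congrArg (fun z : GL (Fin n) (A ⧸ M) => (z : Matrix (Fin n) (Fin n) (A ⧸ M)) i j) hk
  rw [← Ideal.Quotient.eq_zero_iff_mem, map_sub, sub_eq_zero]
  have h' : Ideal.Quotient.mk M ((ψ g : Matrix (Fin n) (Fin n) A) i j) =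
    (1 : Matrix (Fin n) (Fin n) (A ⧸ M)) i j := h
  rw [h', Matrix.one_apply, Matrix.one_apply]
  split_ifs <;> simp
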